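/- arXiv:2404.05155 — 5 statements merged into one kernel-verified Lean document; each statement's English description precedes it below -/
import Mathlib

section
/- For WSU-UX with K = 2 arms run with any learning rate η < T^{−2/3} and any exploration parameter γ ≥ 0 (within a valid setting), on the loss sequence ℓ_{t,1} = 0, ℓ_{t,2} = 1 for all 1 ≤ t ≤ T, the expected regret satisfies E[R_T] ≥ (1/200)·T^{2/3}. -/
open MeasureTheory ProbabilityTheory Real Finset

noncomputable section

/-- A run of the WSU-UX bandit algorithm with `K` expert arms, horizon `T`,
learning rate `η`, exploration parameter `γ`, on the oblivious loss sequence `ℓ`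
(rounds are indexed `1, …, T`; arms are indexed by `Fin K`, with arm 1 = index `0`).

The data consists of a filtration `F`, the arms `I t` drawn at each round, and the
probability vectors `π t` maintained by the algorithm, subject to:
* `π 1 i = 1/K` (initialization);
* `π t` is `F (t-1)`-measurable and the conditional law of `I t` given `F (t-1)` is
  `π̃ t i = (1-γ) π t i + γ/K` (uniform-exploration mixing);
* the WSU update `π (t+1) i = π t i (1 - η (ℓ̂ t i - Σ_j π t j ℓ̂ t j))`, where
  `ℓ̂ t i = ℓ t i · 1[I t = i] / π̃ t i` is the importance-weighted loss estimate. -/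
structure WSUUX (K T : ℕ) (η γ : ℝ) (ℓ : ℕ → Fin K → ℝ) (Ω : Type)
    [MeasurableSpace Ω] (P : Measure Ω) where
  F : ℕ → MeasurableSpace Ω
  F_le : ∀ t, F t ≤ ‹MeasurableSpace Ω›
  F_mono : Monotone F
  I : ℕ → Ω → Fin K
  I_meas : ∀ t, Measurable[F t] (I t)
  pi : ℕ → Ω → Fin K → ℝ
  pi_meas : ∀ t i, Measurable[F (t - 1)] fun ω => pi t ω i
  pi_init : ∀ ω i, pi 1 ω i = 1 / K
  law : ∀ t, 1 ≤ t → ∀ i,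
    P[(fun ω => if I t ω = i then (1 : ℝ) else 0)|F (t - 1)] =ᵐ[P]
      fun ω => (1 - γ) * pi t ω i + γ / K
  update : ∀ t, 1 ≤ t → ∀ ω i,
    pi (t + 1) ω i = pi t ω i * (1 - η *
      (ℓ t i * (if I t ω = i then 1 else 0) / ((1 - γ) * pi t ω i + γ / K)
        - ∑ j, pi t ω j *
            (ℓ t j * (if I t ω = j then 1 else 0) / ((1 - γ) * pi t ω j + γ / K))))

namespace WSUUX

variable {K T : ℕ} {η γ : ℝ} {ℓ : ℕ → Fin K → ℝ} {Ω : Type} [MeasurableSpace Ω]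
  {P : Measure Ω}

/-- The exploration-mixed sampling distribution `π̃_{t,i} = (1-γ) π_{t,i} + γ/K`. -/
def ptilde (run : WSUUX K T η γ ℓ Ω P) (t : ℕ) (ω : Ω) (i : Fin K) : ℝ :=
  (1 - γ) * run.pi t ω i + γ / K

/-- The importance-weighted loss estimate `ℓ̂_{t,i} = ℓ_{t,i} · 1[I_t = i] / π̃_{t,i}`. -/
def lhat (run : WSUUX K T η γ ℓ Ω P) (t : ℕ) (ω : Ω) (i : Fin K) : ℝ :=
  ℓ t i * (if run.I t ω = i then 1 else 0) / run.ptilde t ω i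

/-- The expected regret
`E[Σ_{t=1}^T Σ_j π̃_{t,j} ℓ_{t,j}] − min_i Σ_{t=1}^T ℓ_{t,i}`. -/
def regret (run : WSUUX K T η γ ℓ Ω P) : ℝ :=
  (∫ ω, ∑ t ∈ Finset.Icc 1 T, ∑ j, run.ptilde t ω j * ℓ t j ∂P)
    - ⨅ i : Fin K, ∑ t ∈ Finset.Icc 1 T, ℓ t i

end WSUUX

/-- Valid hyperparameters: `η, γ ∈ (0, 1/2)` and `ηK/γ ≤ 1/2`. -/
def validParams (K : ℕ) (η γ : ℝ) : Prop :=
  0 < η ∧ η < 1 / 2 ∧ 0 < γ ∧ γ < 1 / 2 ∧ η * K / γ ≤ 1 / 2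

/-- The non-trivial hyperparameter regime: `η ≥ T^{-2/3}` and `γ ≤ T^{-1/3}`. -/
def nontrivialRegime (T : ℕ) (η γ : ℝ) : Prop :=
  (T : ℝ) ^ (-(2 : ℝ) / 3) ≤ η ∧ γ ≤ (T : ℝ) ^ (-(1 : ℝ) / 3)

/-- The hard loss sequence for `K = 2` arms: arm 1 (index `0`) has loss `1` and
arm 2 (index `1`) has loss `0` for `1 ≤ t ≤ T/100` (Phase 1), and the losses are
swapped for `T/100 < t ≤ T` (Phase 2). -/
def hardLoss (T : ℕ) : ℕ → Fin 2 → ℝ := fun t i =>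
  if t ≤ T / 100 then (if i = 0 then 1 else 0) else (if i = 0 then 0 else 1)

end

/-- The loss sequence `ℓ_{t,1} = 0, ℓ_{t,2} = 1` for all rounds `t`. -/
def armTwoLoss : ℕ → Fin 2 → ℝ := fun _ i => if i = 0 then 0 else 1

namespace WSUUX

section ArmTwoLoss

variable {T : ℕ} {η γ : ℝ} {Ω : Type} [MeasurableSpace Ω] {P : Measure Ω}

theorem pi_succ_armTwoLoss (run : WSUUX 2 T η γ armTwoLoss Ω P) {t : ℕ} (ht : 1 ≤ t) (ω : Ω) :
    run.pi (t + 1) ω 1 = run.pi t ω 1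
      - η * run.pi t ω 1 * (1 - run.pi t ω 1) / run.ptilde t ω 1
        * (if run.I t ω = 1 then 1 else 0) := by
  have h := run.update t ht ω 1
  simp only [armTwoLoss, Fin.sum_univ_two, one_ne_zero, if_true, if_false, one_mul, zero_mul,
    zero_div, mul_zero, zero_add] at h
  rw [h, ptilde]
  ring

theorem half_gamma_le_ptilde (run : WSUUX 2 T η γ armTwoLoss Ω P) (hγ : γ ≤ 1) {t : ℕ} {ω : Ω}
    (h : 0 ≤ run.pi t ω 1) : γ / 2 ≤ run.ptilde t ω 1 := by
  have := mul_nonneg (sub_nonneg.2 hγ) h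
  simp only [ptilde, Nat.cast_ofNat]
  linarith

theorem pi_mem_Icc_armTwoLoss (run : WSUUX 2 T η γ armTwoLoss Ω P) (hvalid : validParams 2 η γ)
    {t : ℕ} (ht : 1 ≤ t) (ω : Ω) : run.pi t ω 1 ∈ Set.Icc (0 : ℝ) (1 / 2) := by
  obtain ⟨hη0, -, hγ0, hγ1, hηγ⟩ := hvalid
  rw [div_le_iff₀ hγ0, Nat.cast_ofNat] at hηγ
  induction t, ht using Nat.le_induction with
  | base => rw [run.pi_init]; norm_num
  | succ t ht ih =>
    obtain ⟨h0, h1⟩ := ih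
    have hq := run.half_gamma_le_ptilde (by linarith) h0
    have hq0 : 0 < run.ptilde t ω 1 := by linarith
    rw [run.pi_succ_armTwoLoss ht]
    have hstep0 : 0 ≤ η * run.pi t ω 1 * (1 - run.pi t ω 1) / run.ptilde t ω 1 :=
      div_nonneg (mul_nonneg (mul_nonneg hη0.le h0) (by linarith)) hq0.le
    have hstep1 : η * run.pi t ω 1 * (1 - run.pi t ω 1) / run.ptilde t ω 1 ≤ run.pi t ω 1 := by
      rw [div_le_iff₀ hq0]
      nlinarith [mul_nonneg hη0.le h0, mul_nonneg (mul_nonneg hη0.le h0) h0,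
        mul_le_mul_of_nonneg_left hq h0]
    split_ifs <;> constructor <;> linarith

theorem measurable_pi (run : WSUUX 2 T η γ armTwoLoss Ω P) (t : ℕ) (i : Fin 2) :
    Measurable fun ω => run.pi t ω i :=
  (run.pi_meas t i).mono (run.F_le _) le_rfl

theorem integrable_pi_armTwoLoss [IsProbabilityMeasure P] (run : WSUUX 2 T η γ armTwoLoss Ω P)
    (hvalid : validParams 2 η γ) {t : ℕ} (ht : 1 ≤ t) : Integrable (fun ω => run.pi t ω 1) P :=
  Integrable.of_mem_Icc 0 (1 / 2) (run.measurable_pi t 1).aemeasurable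
    (ae_of_all _ fun ω => run.pi_mem_Icc_armTwoLoss hvalid ht ω)

theorem integral_pi_succ_armTwoLoss [IsProbabilityMeasure P]
    (run : WSUUX 2 T η γ armTwoLoss Ω P) (hvalid : validParams 2 η γ) {t : ℕ} (ht : 1 ≤ t) :
    (1 - η) * ∫ ω, run.pi t ω 1 ∂P ≤ ∫ ω, run.pi (t + 1) ω 1 ∂P := by
  have hη0 : 0 < η := hvalid.1
  have hγ0 : 0 < γ := hvalid.2.2.1
  have hγ1 : γ < 1 / 2 := hvalid.2.2.2.1
  have hp := fun ω => run.pi_mem_Icc_armTwoLoss hvalid ht ω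
  have hpi := run.integrable_pi_armTwoLoss hvalid ht
  have hpi_succ := run.integrable_pi_armTwoLoss hvalid (t := t + 1) (by omega)
  set X : Ω → ℝ := fun ω => if run.I t ω = 1 then 1 else 0 with hX
  set g : Ω → ℝ := fun ω =>
    η * run.pi t ω 1 * (1 - run.pi t ω 1) / run.ptilde t ω 1 with hg
  have hpm := run.pi_meas t 1
  have hgm : Measurable[run.F (t - 1)] g := by
    simp only [hg, ptilde]
    exact ((hpm.const_mul η).mul (hpm.const_sub 1)).div ((hpm.const_mul (1 - γ)).add_const _)
  have hXm : Measurable X :=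
    Measurable.ite ((run.I_meas t).mono (run.F_le t) le_rfl (measurableSet_singleton 1))
      measurable_const measurable_const
  have hXi : Integrable X P := Integrable.of_mem_Icc 0 1 hXm.aemeasurable
    (ae_of_all _ fun ω => by simp only [hX]; split_ifs <;> norm_num)
  have hgX : g * X = fun ω => run.pi t ω 1 - run.pi (t + 1) ω 1 := by
    funext ω
    rw [run.pi_succ_armTwoLoss ht]
    simp [hg, hX]
  have hgXi : Integrable (g * X) P := hgX ▸ hpi.sub hpi_succ
  have hcond : P[g * X|run.F (t - 1)] =ᵐ[P]
      fun ω => η * run.pi t ω 1 * (1 - run.pi t ω 1) := by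
    filter_upwards [condExp_mul_of_stronglyMeasurable_left hgm.stronglyMeasurable hgXi hXi,
      run.law t ht 1] with ω h1 h2
    have hq := run.half_gamma_le_ptilde (by linarith) (hp ω).1
    rw [h1, Pi.mul_apply, h2]
    exact div_mul_cancel₀ _ (by linarith : 0 < run.ptilde t ω 1).ne'
  have hle : ∫ ω, (g * X) ω ∂P ≤ ∫ ω, η * run.pi t ω 1 ∂P := by
    rw [← integral_condExp (run.F_le (t - 1))]
    refine integral_mono_ae integrable_condExp (hpi.const_mul η) ?_
    filter_upwards [hcond] with ω h
    rw [h]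
    nlinarith [mul_nonneg hη0.le (hp ω).1, mul_nonneg (mul_nonneg hη0.le (hp ω).1) (hp ω).1]
  rw [hgX, integral_sub hpi hpi_succ, integral_const_mul] at hle
  linarith

theorem half_mul_pow_le_integral_pi_armTwoLoss [IsProbabilityMeasure P]
    (run : WSUUX 2 T η γ armTwoLoss Ω P) (hvalid : validParams 2 η γ) (n : ℕ) :
    1 / 2 * (1 - η) ^ n ≤ ∫ ω, run.pi (n + 1) ω 1 ∂P := by
  induction n with
  | zero => simp [run.pi_init]
  | succ n ih =>
    have h := run.integral_pi_succ_armTwoLoss hvalid (t := n + 1) (by omega)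
    have hη1 : 0 ≤ 1 - η := by linarith [hvalid.2.1]
    calc 1 / 2 * (1 - η) ^ (n + 1) = (1 - η) * (1 / 2 * (1 - η) ^ n) := by ring
      _ ≤ _ := mul_le_mul_of_nonneg_left ih hη1
      _ ≤ _ := h

theorem sum_pow_le_regret_armTwoLoss [IsProbabilityMeasure P]
    (run : WSUUX 2 T η γ armTwoLoss Ω P) (hvalid : validParams 2 η γ) :
    1 / 2 * ∑ n ∈ range T, (1 - η) ^ n ≤ run.regret := by
  have hinf : ⨅ i : Fin 2, ∑ t ∈ Finset.Icc 1 T, armTwoLoss t i ≤ 0 :=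
    (ciInf_le (Set.finite_range _).bddBelow 0).trans_eq (by simp [armTwoLoss])
  have hloss : ∀ t ω, ∑ j, run.ptilde t ω j * armTwoLoss t j = run.ptilde t ω 1 := by
    simp [armTwoLoss]
  have hqi : ∀ t ∈ Finset.Icc 1 T, Integrable (fun ω => run.ptilde t ω 1) P := fun t ht =>
    ((run.integrable_pi_armTwoLoss hvalid (mem_Icc.1 ht).1).const_mul _).add (integrable_const _)
  have hpq : ∑ t ∈ Finset.Icc 1 T, ∫ ω, run.pi t ω 1 ∂P
      ≤ ∑ t ∈ Finset.Icc 1 T, ∫ ω, run.ptilde t ω 1 ∂P := by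
    refine sum_le_sum fun t ht => integral_mono
      (run.integrable_pi_armTwoLoss hvalid (mem_Icc.1 ht).1) (hqi t ht) fun ω => ?_
    have h := (run.pi_mem_Icc_armTwoLoss hvalid (mem_Icc.1 ht).1 ω).2
    simp only [ptilde, Nat.cast_ofNat]
    nlinarith [mul_le_mul_of_nonneg_left h hvalid.2.2.1.le]
  have hsum : 1 / 2 * ∑ n ∈ range T, (1 - η) ^ n
      ≤ ∑ t ∈ Finset.Icc 1 T, ∫ ω, run.pi t ω 1 ∂P := by
    rw [← Finset.Ico_add_one_right_eq_Icc, Finset.sum_Ico_eq_sum_range, Finset.mul_sum]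
    refine sum_le_sum fun n _ => ?_
    rw [add_comm 1 n]
    exact run.half_mul_pow_le_integral_pi_armTwoLoss hvalid n
  unfold regret
  simp only [hloss]
  rw [integral_finsetSum _ hqi]
  linarith

end ArmTwoLoss

end WSUUX

theorem half_inv_le_sum_one_sub_pow {s : ℝ} {n : ℕ} (hs0 : 0 < s) (hs1 : s ≤ 1)
    (hn : 1 ≤ n * s) : 1 / 2 * s⁻¹ ≤ ∑ k ∈ range n, (1 - s) ^ k := by
  have hgeom := mul_neg_geom_sum (1 - s) n
  have hpow : 0 ≤ (1 - s) ^ n := pow_nonneg (by linarith) n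
  have hbern : 1 + n * s ≤ (1 + s) ^ n := one_add_mul_le_pow (by linarith) n
  have hprod : (1 - s) ^ n * (1 + s) ^ n ≤ 1 := by
    rw [← mul_pow]
    exact pow_le_one₀ (mul_nonneg (by linarith) (by linarith)) (by nlinarith)
  have hhalf : (1 - s) ^ n ≤ 1 / 2 := by
    nlinarith [mul_le_mul_of_nonneg_left hbern hpow, mul_le_mul_of_nonneg_left hn hpow]
  rw [← div_eq_mul_inv, div_le_iff₀ hs0]
  linarith

/-- For WSU-UX with `K = 2` arms run with any learning rate `η < T^{−2/3}`
and any exploration parameter `γ ≥ 0` (within a valid setting), on the loss sequence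
`ℓ_{t,1} = 0, ℓ_{t,2} = 1` for all `1 ≤ t ≤ T`, the expected regret satisfies
`E[R_T] ≥ (1/200)·T^{2/3}`. -/
theorem wsuux_lower_bound_small_eta (T : ℕ) (η γ : ℝ) (hvalid : validParams 2 η γ)
    (hη : η < (T : ℝ) ^ (-(2 : ℝ) / 3))
    (Ω : Type) [MeasurableSpace Ω] (P : Measure Ω) [IsProbabilityMeasure P]
    (run : WSUUX 2 T η γ armTwoLoss Ω P) :
    (1 / 200 : ℝ) * (T : ℝ) ^ ((2 : ℝ) / 3) ≤ run.regret := by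
  have hη0 : 0 < η := hvalid.1
  have hT : 1 ≤ T := by
    rcases Nat.eq_zero_or_pos T with rfl | h
    · rw [Nat.cast_zero, Real.zero_rpow (by norm_num)] at hη
      linarith
    · exact h
  have hT1 : (1 : ℝ) ≤ T := by exact_mod_cast hT
  have hT0 : (0 : ℝ) < T := by linarith
  set s : ℝ := (T : ℝ) ^ (-(2 : ℝ) / 3) with hs
  have hs1 : s ≤ 1 := Real.rpow_le_one_of_one_le_of_nonpos hT1 (by norm_num)
  have hsinv : s⁻¹ = (T : ℝ) ^ ((2 : ℝ) / 3) := by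
    rw [hs, ← Real.rpow_neg hT0.le]
    norm_num
  have hTs : 1 ≤ T * s := by
    rw [hs, ← Real.rpow_one_add' hT0.le (by norm_num)]
    exact Real.one_le_rpow hT1 (by norm_num)
  have hgeom := half_inv_le_sum_one_sub_pow (hη0.trans hη) hs1 hTs
  have hmono : ∑ n ∈ range T, (1 - s) ^ n ≤ ∑ n ∈ range T, (1 - η) ^ n :=
    sum_le_sum fun n _ => pow_le_pow_left₀ (by linarith) (by linarith) n
  have hreg := run.sum_pow_le_regret_armTwoLoss hvalid
  have hpos : 0 < s⁻¹ := inv_pos.2 (hη0.trans hη)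
  rw [← hsinv]
  linarith
end

section
/- When WSU-UX with K = 2 arms and any valid hyperparameter setting (η, γ) is run on the hard loss sequence, then for every realization of the algorithm's randomness, Σ_{t=1}^T Σ_{j∈[K]} π_{t,j} ℓ̂_{t,j} − Σ_{t=1}^T ℓ̂_{t,1} ≥ (ln π_{T+1,1} + ln K)/η + (η/4)·Σ_{t=1}^T (ℓ̂_{t,1} − Σ_{j∈[K]} π_{t,j} ℓ̂_{t,j})². -/
open MeasureTheory ProbabilityTheory Real Finset

theorem log_one_sub_le_of_abs_le_half {x : ℝ} (hx : |x| ≤ 1 / 2) :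
    Real.log (1 - x) ≤ -x - x ^ 2 / 4 := by
  obtain ⟨h1, h2⟩ := abs_le.mp hx
  have hpos : 0 < 1 - x := by linarith
  rw [Real.log_le_iff_le_exp hpos]
  obtain ⟨z, hz⟩ : ∃ z, z = -x - x ^ 2 / 4 := ⟨_, rfl⟩
  rw [← hz]
  have hz1 : -(9 / 16) ≤ z := by nlinarith
  have hexp : (1 + z / 4) ^ 4 ≤ Real.exp z := by
    calc (1 + z / 4) ^ 4 ≤ Real.exp (z / 4) ^ 4 :=
          pow_le_pow_left₀ (by linarith) (by linarith [Real.add_one_le_exp (z / 4)]) 4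
      _ = Real.exp z := by rw [← Real.exp_nat_mul]; congr 1; push_cast; ring
  have hquad : 1 + z + z ^ 2 / 3 ≤ (1 + z / 4) ^ 4 := by
    have : 0 ≤ z ^ 2 * (1 / 24 + z / 16 + z ^ 2 / 256) :=
      mul_nonneg (sq_nonneg z) (by nlinarith)
    nlinarith
  have hsq : 49 / 64 * x ^ 2 ≤ z ^ 2 := by
    have hz2 : z ^ 2 = x ^ 2 * (1 + x / 4) ^ 2 := by rw [hz]; ring
    rw [hz2, mul_comm]
    exact mul_le_mul_of_nonneg_left (by nlinarith) (sq_nonneg x)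
  nlinarith [sq_nonneg x]

namespace WSUUX

variable {T : ℕ} {η γ : ℝ} {Ω : Type} [MeasurableSpace Ω] {P : Measure Ω}

theorem pi_succ {K : ℕ} {ℓ : ℕ → Fin K → ℝ} (run : WSUUX K T η γ ℓ Ω P) {t : ℕ} (ht : 1 ≤ t)
    (ω : Ω) (i : Fin K) :
    run.pi (t + 1) ω i = run.pi t ω i *
      (1 - η * (run.lhat t ω i - ∑ j, run.pi t ω j * run.lhat t ω j)) :=
  run.update t ht ω i

theorem lhat_mem_Icc {ℓ : ℕ → Fin 2 → ℝ} (hℓ : ∀ t i, ℓ t i ∈ Set.Icc (0 : ℝ) 1)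
    (hγ : 0 < γ) (hγ' : γ < 1) (run : WSUUX 2 T η γ ℓ Ω P) {t : ℕ} {ω : Ω} {i : Fin 2}
    (hpi : 0 ≤ run.pi t ω i) : run.lhat t ω i ∈ Set.Icc 0 (2 / γ) := by
  have hp : γ / 2 ≤ run.ptilde t ω i := by
    have : 0 ≤ (1 - γ) * run.pi t ω i := mul_nonneg (by linarith) hpi
    simp only [ptilde, Nat.cast_ofNat]
    linarith
  obtain ⟨h0, h1⟩ := hℓ t i
  have hnum : 0 ≤ ℓ t i * (if run.I t ω = i then (1 : ℝ) else 0) ∧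
      ℓ t i * (if run.I t ω = i then (1 : ℝ) else 0) ≤ 1 := by
    split_ifs <;> simp [h0, h1]
  have hγ2 : 0 < γ / 2 := by linarith
  refine ⟨div_nonneg hnum.1 (hγ2.le.trans hp), ?_⟩
  calc run.lhat t ω i ≤ 1 / (γ / 2) := div_le_div₀ zero_le_one hnum.2 hγ2 hp
    _ = 2 / γ := by field_simp

theorem abs_mul_lhat_sub_le {ℓ : ℕ → Fin 2 → ℝ} (hℓ : ∀ t i, ℓ t i ∈ Set.Icc (0 : ℝ) 1)
    (hvalid : validParams 2 η γ) (run : WSUUX 2 T η γ ℓ Ω P) {t : ℕ} {ω : Ω}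
    (hpi : ∀ i, 0 < run.pi t ω i) (hsum : ∑ i, run.pi t ω i = 1) (i : Fin 2) :
    |η * (run.lhat t ω i - ∑ j, run.pi t ω j * run.lhat t ω j)| ≤ 1 / 2 := by
  obtain ⟨hη, -, hγ, hγ', hle⟩ := hvalid
  have hl := fun j => run.lhat_mem_Icc hℓ hγ (by linarith) (hpi j).le
  have hlow : 0 ≤ ∑ j, run.pi t ω j * run.lhat t ω j :=
    Finset.sum_nonneg fun j _ => mul_nonneg (hpi j).le (hl j).1
  have hup : ∑ j, run.pi t ω j * run.lhat t ω j ≤ 2 / γ :=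
    calc ∑ j, run.pi t ω j * run.lhat t ω j ≤ ∑ j, run.pi t ω j * (2 / γ) :=
          Finset.sum_le_sum fun j _ => mul_le_mul_of_nonneg_left (hl j).2 (hpi j).le
      _ = 2 / γ := by rw [← Finset.sum_mul, hsum, one_mul]
  have hbound : |run.lhat t ω i - ∑ j, run.pi t ω j * run.lhat t ω j| ≤ 2 / γ :=
    abs_le.mpr ⟨by linarith [(hl i).1], by linarith [(hl i).2]⟩
  rw [abs_mul, abs_of_pos hη]
  calc η * _ ≤ η * (2 / γ) := mul_le_mul_of_nonneg_left hbound hη.le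
    _ = η * (2 : ℕ) / γ := by push_cast; ring
    _ ≤ 1 / 2 := hle

theorem pi_pos_and_sum_pi {ℓ : ℕ → Fin 2 → ℝ} (hℓ : ∀ t i, ℓ t i ∈ Set.Icc (0 : ℝ) 1)
    (hvalid : validParams 2 η γ) (run : WSUUX 2 T η γ ℓ Ω P) (ω : Ω) (n : ℕ) :
    (∀ i, 0 < run.pi (n + 1) ω i) ∧ ∑ i, run.pi (n + 1) ω i = 1 := by
  induction n with
  | zero => simp [run.pi_init]
  | succ n ih =>
    obtain ⟨hpi, hsum⟩ := ih
    refine ⟨fun i => ?_, ?_⟩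
    · rw [run.pi_succ n.succ_pos]
      have := (abs_le.mp (run.abs_mul_lhat_sub_le hℓ hvalid hpi hsum i)).2
      exact mul_pos (hpi i) (by linarith)
    · simp only [run.pi_succ n.succ_pos]
      simp only [Fin.sum_univ_two] at hsum ⊢
      linear_combination (1 + η * (run.pi (n + 1) ω 0 * run.lhat (n + 1) ω 0
        + run.pi (n + 1) ω 1 * run.lhat (n + 1) ω 1)) * hsum

theorem log_pi_add_sum_sq_le {ℓ : ℕ → Fin 2 → ℝ} (hℓ : ∀ t i, ℓ t i ∈ Set.Icc (0 : ℝ) 1)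
    (hvalid : validParams 2 η γ) (run : WSUUX 2 T η γ ℓ Ω P) (ω : Ω) (i : Fin 2) (n : ℕ) :
    (Real.log (run.pi (n + 1) ω i) + Real.log 2) / η
        + η / 4 * ∑ t ∈ Finset.Icc 1 n,
            (run.lhat t ω i - ∑ j, run.pi t ω j * run.lhat t ω j) ^ 2
      ≤ (∑ t ∈ Finset.Icc 1 n, ∑ j, run.pi t ω j * run.lhat t ω j)
          - ∑ t ∈ Finset.Icc 1 n, run.lhat t ω i := by
  induction n with
  | zero => simp [run.pi_init]
  | succ n ih =>
    obtain ⟨hpi, hsum⟩ := run.pi_pos_and_sum_pi hℓ hvalid ω n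
    have habs := run.abs_mul_lhat_sub_le hℓ hvalid hpi hsum i
    have hlog := log_one_sub_le_of_abs_le_half habs
    have hη := hvalid.1
    simp only [Finset.sum_Icc_succ_top (Nat.le_add_left 1 n)]
    have hpos := (abs_le.mp habs).2
    rw [run.pi_succ n.succ_pos, Real.log_mul (hpi i).ne' (by linarith)]
    set d := run.lhat (n + 1) ω i - ∑ j, run.pi (n + 1) ω j * run.lhat (n + 1) ω j with hd
    have hstep : Real.log (1 - η * d) / η ≤ -d - η / 4 * d ^ 2 := by
      rw [div_le_iff₀ hη]
      linarith
    rw [add_right_comm, add_div]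
    linarith

end WSUUX

theorem hardLoss_mem_Icc (T t : ℕ) (i : Fin 2) : hardLoss T t i ∈ Set.Icc (0 : ℝ) 1 := by
  unfold hardLoss
  split_ifs <;> simp

/-- When WSU-UX with `K = 2` arms and any valid `(η, γ)` is run on the hard
loss sequence, then for every realization of the algorithm's randomness,
`Σ_{t=1}^T Σ_j π_{t,j} ℓ̂_{t,j} − Σ_{t=1}^T ℓ̂_{t,1}
  ≥ (ln π_{T+1,1} + ln K)/η + (η/4)·Σ_{t=1}^T (ℓ̂_{t,1} − Σ_j π_{t,j} ℓ̂_{t,j})²`. -/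
theorem wsuux_second_order_lower_bound (T : ℕ) (η γ : ℝ) (hvalid : validParams 2 η γ)
    (Ω : Type) [MeasurableSpace Ω] (P : Measure Ω) [IsProbabilityMeasure P]
    (run : WSUUX 2 T η γ (hardLoss T) Ω P) (ω : Ω) :
    (Real.log (run.pi (T + 1) ω 0) + Real.log 2) / η
        + η / 4 * ∑ t ∈ Finset.Icc 1 T,
            (run.lhat t ω 0 - ∑ j, run.pi t ω j * run.lhat t ω j) ^ 2
      ≤ (∑ t ∈ Finset.Icc 1 T, ∑ j, run.pi t ω j * run.lhat t ω j)
          - ∑ t ∈ Finset.Icc 1 T, run.lhat t ω 0 := by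
  exact run.log_pi_add_sum_sq_le (hardLoss_mem_Icc T) hvalid ω 0 T
end

section
/- When WSU-UX with K = 2 arms and any valid hyperparameter setting (η, γ) is run on the hard loss sequence, then for any δ ∈ (0,1) such that ε = √(3·ln(1/δ)/((2γ/K)·T₁)) lies in (0,1], with probability at least 1 − δ the probability of arm 1 at the end of Phase 1 satisfies π_{T₁+1,1} ≥ 2^{−𝓜}, where 𝓜 = (1/ln 2)·(2(1+ε)(1+ηK/γ)·η·T₁ + ln(2K/γ)) and T₁ = T/100. -/
open MeasureTheory ProbabilityTheory Real Finset

/-- The quantity `ε = √(3·ln(1/δ) / ((2γ/K)·T₁))` with `K = 2`, `T₁ = T/100`. -/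
noncomputable def eps1 (T : ℕ) (γ δ : ℝ) : ℝ :=
  Real.sqrt (3 * Real.log (1 / δ) / (2 * γ / 2 * ((T / 100 : ℕ) : ℝ)))

/-- The exponent `𝓜 = (1/ln 2)·(2(1+ε)(1+ηK/γ)·η·T₁ + ln(2K/γ))` with `K = 2`. -/
noncomputable def Mexp (T : ℕ) (η γ δ : ℝ) : ℝ :=
  (1 / Real.log 2) *
    (2 * (1 + eps1 T γ δ) * (1 + η * 2 / γ) * η * ((T / 100 : ℕ) : ℝ)
      + Real.log (2 * 2 / γ))

/-- In Phase 1 arm 2 incurs no loss, so the weight of arm 1 has an autonomous update. -/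
lemma pi_zero_succ {T : ℕ} {η γ : ℝ} {Ω : Type} [MeasurableSpace Ω] {P : Measure Ω}
    (run : WSUUX 2 T η γ (hardLoss T) Ω P) {n : ℕ} (hn : n < T / 100) (ω : Ω) :
    run.pi (n + 1 + 1) ω 0 = run.pi (n + 1) ω 0 *
      (1 - if run.I (n + 1) ω = 0 then
        η * (1 - run.pi (n + 1) ω 0) / ((1 - γ) * run.pi (n + 1) ω 0 + γ / 2) else 0) := by
  have h : n + 1 ≤ T / 100 := hn
  rw [run.update (n + 1) (by omega)]
  simp only [hardLoss, h, if_true, Fin.sum_univ_two]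
  split_ifs <;> simp_all
  exact Or.inl (by ring)

lemma loss_step_nonneg_and_le {η γ p : ℝ} (hη : 0 < η) (hγ : 0 < γ) (hγ' : γ < 1 / 2)
    (hp : 0 < p) (hp1 : p ≤ 1) :
    0 ≤ η * (1 - p) / ((1 - γ) * p + γ / 2) ∧
      η * (1 - p) / ((1 - γ) * p + γ / 2) ≤ η * 2 / γ := by
  have h1 : 0 < (1 - γ) * p := mul_pos (by linarith) hp
  refine ⟨div_nonneg (mul_nonneg hη.le (by linarith)) (by linarith), ?_⟩
  rw [div_le_div_iff₀ (by linarith) hγ]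
  nlinarith [mul_pos hη h1, mul_pos (mul_pos hη hp) hγ]

lemma exp_neg_mul_one_add_le_one_sub {x : ℝ} (hx : 0 ≤ x) (hx' : x ≤ 1 / 2) :
    Real.exp (-(x * (1 + x))) ≤ 1 - x := by
  have h := Real.quadratic_le_exp_of_nonneg (x := x * (1 + x)) (by positivity)
  rw [Real.exp_neg]
  refine inv_le_of_inv_le₀ (by linarith) (le_trans ?_ h)
  rw [inv_le_iff_one_le_mul₀ (by linarith)]
  nlinarith [mul_nonneg hx hx, mul_nonneg (mul_nonneg hx hx) hx,
    mul_nonneg (mul_nonneg hx hx) (sub_nonneg.2 hx'),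
    mul_nonneg (mul_nonneg (mul_nonneg hx hx) hx) (sub_nonneg.2 hx'),
    mul_nonneg (mul_nonneg (mul_nonneg hx hx) (mul_nonneg hx hx)) (sub_nonneg.2 hx')]

lemma pi_zero_mem_Ioc {T : ℕ} {η γ : ℝ} (hv : validParams 2 η γ) {Ω : Type}
    [MeasurableSpace Ω] {P : Measure Ω} (run : WSUUX 2 T η γ (hardLoss T) Ω P)
    {n : ℕ} (hn : n ≤ T / 100) (ω : Ω) : run.pi (n + 1) ω 0 ∈ Set.Ioc (0 : ℝ) 1 := by
  obtain ⟨hη, -, hγ, hγ', hηγ⟩ := hv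
  push_cast at hηγ
  induction n with
  | zero => rw [run.pi_init]; norm_num
  | succ n ih =>
    obtain ⟨h0, h1⟩ := ih (by omega)
    rw [pi_zero_succ run hn]
    obtain ⟨ha, hb⟩ := loss_step_nonneg_and_le hη hγ hγ' h0 h1
    split_ifs
    · exact ⟨mul_pos h0 (by linarith), mul_le_one₀ h1 (by linarith) (by linarith)⟩
    · simpa using And.intro h0 h1

/-- The number of rounds among the first `n` in which arm 1 is drawn while its weight is
below `γ / 2`. -/
noncomputable def lowWeightDraws {T : ℕ} {η γ : ℝ} {Ω : Type} [MeasurableSpace Ω] {P : Measure Ω}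
    (run : WSUUX 2 T η γ (hardLoss T) Ω P) : ℕ → Ω → ℕ
  | 0, _ => 0
  | n + 1, ω => lowWeightDraws run n ω +
      if run.pi (n + 1) ω 0 < γ / 2 ∧ run.I (n + 1) ω = 0 then 1 else 0

lemma exp_neg_lowWeightDraws_le_pi_zero {T : ℕ} {η γ : ℝ} (hv : validParams 2 η γ) {Ω : Type}
    [MeasurableSpace Ω] {P : Measure Ω} (run : WSUUX 2 T η γ (hardLoss T) Ω P)
    {n : ℕ} (hn : n ≤ T / 100) (ω : Ω) :
    γ / 4 * Real.exp (-(η * 2 / γ * (1 + η * 2 / γ)) * lowWeightDraws run n ω)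
      ≤ run.pi (n + 1) ω 0 := by
  have hv' := hv
  obtain ⟨hη, -, hγ, hγ', hηγ⟩ := hv'
  push_cast at hηγ
  have hx : 0 ≤ η * 2 / γ := by positivity
  induction n with
  | zero => rw [run.pi_init]; simp [lowWeightDraws]; linarith
  | succ n ih =>
    specialize ih (by omega)
    obtain ⟨h0, h1⟩ := pi_zero_mem_Ioc hv run (n := n) (by omega) ω
    rw [pi_zero_succ run hn]
    obtain ⟨ha, hb⟩ := loss_step_nonneg_and_le hη hγ hγ' h0 h1
    by_cases hI : run.I (n + 1) ω = 0
    · rw [if_pos hI]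
      by_cases hp : run.pi (n + 1) ω 0 < γ / 2
      · simp only [lowWeightDraws, hp, hI, and_self, if_true]
        push_cast
        rw [mul_add, Real.exp_add, ← mul_assoc, mul_one]
        refine mul_le_mul ih ?_ (Real.exp_pos _).le h0.le
        have := exp_neg_mul_one_add_le_one_sub hx hηγ
        linarith
      · have hle : Real.exp (-(η * 2 / γ * (1 + η * 2 / γ)) * lowWeightDraws run (n + 1) ω) ≤ 1 :=
          Real.exp_le_one_iff.2 (mul_nonpos_of_nonpos_of_nonneg
            (neg_nonpos.2 (by positivity)) (Nat.cast_nonneg _))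
        push Not at hp
        nlinarith
    · simpa [hI, lowWeightDraws] using ih

lemma measurable_lowWeightDraws {T : ℕ} {η γ : ℝ} {Ω : Type} [MeasurableSpace Ω] {P : Measure Ω}
    (run : WSUUX 2 T η γ (hardLoss T) Ω P) (n : ℕ) :
    Measurable[run.F n] (lowWeightDraws run n) := by
  induction n with
  | zero => exact measurable_const
  | succ n ih =>
    have hle : run.F n ≤ run.F (n + 1) := run.F_mono n.le_succ
    have hset : MeasurableSet[run.F (n + 1)]
        {ω | run.pi (n + 1) ω 0 < γ / 2 ∧ run.I (n + 1) ω = 0} :=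
      MeasurableSet.inter
        (((run.pi_meas (n + 1) 0).mono hle le_rfl) measurableSet_Iio)
        (run.I_meas (n + 1) (measurableSet_singleton 0))
    exact (ih.mono hle le_rfl).add
      (Measurable.ite (f := fun _ => 1) (g := fun _ => 0) hset measurable_const measurable_const)

lemma lowWeightDraws_le {T : ℕ} {η γ : ℝ} {Ω : Type} [MeasurableSpace Ω] {P : Measure Ω}
    (run : WSUUX 2 T η γ (hardLoss T) Ω P) (n : ℕ) (ω : Ω) : lowWeightDraws run n ω ≤ n := by
  induction n with
  | zero => rfl
  | succ n ih => rw [lowWeightDraws]; split_ifs <;> omega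

lemma integrable_pow_lowWeightDraws {T : ℕ} {η γ ε : ℝ} (hε : 0 ≤ ε) {Ω : Type}
    [MeasurableSpace Ω] {P : Measure Ω} [IsProbabilityMeasure P]
    (run : WSUUX 2 T η γ (hardLoss T) Ω P) (n : ℕ) :
    Integrable (fun ω => (1 + ε) ^ lowWeightDraws run n ω) P := by
  have hm := (measurable_lowWeightDraws run n).mono (run.F_le n) le_rfl
  refine Integrable.of_bound (C := (1 + ε) ^ n)
    ((measurable_from_nat (f := fun k : ℕ => (1 + ε) ^ k)).comp hm).aestronglyMeasurable
    (.of_forall fun ω => ?_)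
  rw [Real.norm_of_nonneg (by positivity)]
  exact pow_le_pow_right₀ (by linarith) (lowWeightDraws_le run n ω)

/-- A low-weight draw has conditional probability at most `γ`, which bounds the generating
function of the number of such draws by that of a binomial variable. -/
lemma integral_pow_lowWeightDraws_le {T : ℕ} {η γ ε : ℝ} (hv : validParams 2 η γ) (hε : 0 ≤ ε)
    {Ω : Type} [MeasurableSpace Ω] {P : Measure Ω} [IsProbabilityMeasure P]
    (run : WSUUX 2 T η γ (hardLoss T) Ω P) {n : ℕ} (hn : n ≤ T / 100) :
    ∫ ω, (1 + ε) ^ lowWeightDraws run n ω ∂P ≤ (1 + ε * γ) ^ n := by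
  have hγ : 0 < γ := hv.2.2.1
  have hγ' : γ < 1 / 2 := hv.2.2.2.1
  induction n with
  | zero => simp [lowWeightDraws]
  | succ n ih =>
    specialize ih (by omega)
    set W : Ω → ℝ := fun ω => (1 + ε) ^ lowWeightDraws run n ω with hW
    set A : Ω → ℝ := fun ω => W ω * if run.pi (n + 1) ω 0 < γ / 2 then 1 else 0 with hA
    set D : Ω → ℝ := fun ω => if run.I (n + 1) ω = 0 then 1 else 0 with hD
    have hWpos (ω) : 0 ≤ W ω := by simp only [hW]; positivity
    have hWint : Integrable W P := integrable_pow_lowWeightDraws hε run n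
    have hWm : Measurable[run.F n] W :=
      (measurable_from_nat (f := fun k : ℕ => (1 + ε) ^ k)).comp (measurable_lowWeightDraws run n)
    have hlow : MeasurableSet[run.F n] {ω | run.pi (n + 1) ω 0 < γ / 2} :=
      run.pi_meas (n + 1) 0 measurableSet_Iio
    have hAm : Measurable[run.F n] A :=
      hWm.mul (Measurable.ite (f := fun _ => (1 : ℝ)) (g := fun _ => 0) hlow
        measurable_const measurable_const)
    have hDm : Measurable D :=
      Measurable.ite ((run.I_meas (n + 1)).mono (run.F_le _) le_rfl (measurableSet_singleton 0))
        measurable_const measurable_const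
    have hDint : Integrable D P := by
      refine Integrable.of_bound (C := 1) hDm.aestronglyMeasurable (.of_forall fun ω => ?_)
      simp only [hD]; split_ifs <;> simp
    have hADint : Integrable (A * D) P := by
      refine hWint.mono ((hAm.mono (run.F_le n) le_rfl).mul hDm).aestronglyMeasurable
        (.of_forall fun ω => ?_)
      simp only [hA, hD, Pi.mul_apply]
      split_ifs <;> simp
    have hstep : (fun ω => (1 + ε) ^ lowWeightDraws run (n + 1) ω)
        = fun ω => W ω + ε * (A * D) ω := by
      ext ω
      simp only [lowWeightDraws, hA, hD, hW, Pi.mul_apply, pow_add]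
      by_cases h1 : run.pi (n + 1) ω 0 < γ / 2 <;> by_cases h2 : run.I (n + 1) ω = 0 <;>
        simp [h1, h2]
      ring
    have hcond : ∫ ω, (A * D) ω ∂P ≤ γ * ∫ ω, W ω ∂P := by
      rw [← integral_condExp (run.F_le n), ← integral_const_mul]
      refine integral_mono_ae integrable_condExp (hWint.const_mul γ) ?_
      filter_upwards [condExp_mul_of_stronglyMeasurable_left hAm.stronglyMeasurable hADint hDint,
        run.law (n + 1) (by omega) 0] with ω h1 h2
      rw [h1, Pi.mul_apply]
      simp only [Nat.add_sub_cancel] at h2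
      rw [h2]
      have hp := (pi_zero_mem_Ioc hv run (n := n) (by omega) ω).1
      simp only [hA]
      split_ifs with hlt
      · rw [mul_one, mul_comm]
        refine mul_le_mul_of_nonneg_right ?_ (hWpos ω)
        push_cast
        nlinarith
      · simpa using mul_nonneg hγ.le (hWpos ω)
    rw [hstep, integral_add hWint (hADint.const_mul ε), integral_const_mul, pow_succ]
    have := mul_le_mul_of_nonneg_left hcond hε
    have := mul_le_mul_of_nonneg_right ih (show 0 ≤ 1 + ε * γ by positivity)
    linarith

lemma sq_div_three_le_one_add_mul_log {ε : ℝ} (h0 : 0 ≤ ε) (h1 : ε ≤ 1) :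
    ε ^ 2 / 3 ≤ (1 + ε) * Real.log (1 + ε) - ε := by
  have h := mul_le_mul_of_nonneg_left (Real.le_log_one_add_of_nonneg h0)
    (show 0 ≤ 1 + ε by linarith)
  have h2 : (1 + ε) * (2 * ε / (ε + 2)) - ε = ε ^ 2 / (ε + 2) := by field_simp; ring
  have h3 : ε ^ 2 / 3 ≤ ε ^ 2 / (ε + 2) :=
    div_le_div_of_nonneg_left (sq_nonneg _) (by linarith) (by linarith)
  linarith

/-- Multiplicative Chernoff bound for the number of low-weight draws in Phase 1. -/
lemma measureReal_lowWeightDraws_ge_le {T : ℕ} {η γ ε : ℝ} (hv : validParams 2 η γ)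
    (hε : 0 ≤ ε) (hε1 : ε ≤ 1) {Ω : Type} [MeasurableSpace Ω] {P : Measure Ω}
    [IsProbabilityMeasure P] (run : WSUUX 2 T η γ (hardLoss T) Ω P) {n : ℕ} (hn : n ≤ T / 100) :
    P.real {ω | (1 + ε) * γ * n ≤ lowWeightDraws run n ω}
      ≤ Real.exp (-(ε ^ 2 * (γ * n) / 3)) := by
  have hγ : 0 < γ := hv.2.2.1
  set L := Real.log (1 + ε) with hL
  have hL0 : 0 ≤ L := Real.log_nonneg (by linarith)
  set a := (1 + ε) * γ * n with ha
  have hpow (k : ℕ) : (1 + ε) ^ k = Real.exp (k * L) := by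
    rw [mul_comm, Real.exp_mul, hL, Real.exp_log (by linarith), Real.rpow_natCast]
  have hmarkov := mul_meas_ge_le_integral_of_nonneg (μ := P)
    (.of_forall fun ω => by positivity) (integrable_pow_lowWeightDraws hε run n) (Real.exp (a * L))
  have hsub : P.real {ω | a ≤ lowWeightDraws run n ω}
      ≤ P.real {ω | Real.exp (a * L) ≤ (1 + ε) ^ lowWeightDraws run n ω} := by
    refine measureReal_mono fun ω hω => ?_
    simp only [Set.mem_ofPred_eq, hpow] at hω ⊢
    exact Real.exp_le_exp.2 (mul_le_mul_of_nonneg_right hω hL0)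
  have hgen : (1 + ε * γ) ^ n ≤ Real.exp (ε * γ * n) := by
    rw [mul_comm (ε * γ), Real.exp_nat_mul]
    refine pow_le_pow_left₀ (by positivity) ?_ n
    linarith [Real.add_one_le_exp (ε * γ)]
  have hbound : P.real {ω | a ≤ lowWeightDraws run n ω} * Real.exp (a * L)
      ≤ Real.exp (ε * γ * n) := by
    have := mul_le_mul_of_nonneg_left hsub (Real.exp_pos (a * L)).le
    linarith [integral_pow_lowWeightDraws_le hv hε run hn]
  rw [← le_div_iff₀ (Real.exp_pos _), ← Real.exp_sub] at hbound
  refine hbound.trans (Real.exp_le_exp.2 ?_)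
  have := mul_le_mul_of_nonneg_right (sq_div_three_le_one_add_mul_log hε hε1)
    (show 0 ≤ γ * n by positivity)
  rw [ha]
  linarith

/-- When WSU-UX with `K = 2` arms and any valid `(η, γ)` is run on the
hard loss sequence, then for any `δ ∈ (0,1)` such that `ε = √(3·ln(1/δ)/((2γ/K)·T₁))`
lies in `(0,1]`, with probability at least `1 − δ` the probability of arm 1 at the end
of Phase 1 satisfies `π_{T₁+1,1} ≥ 2^{−𝓜}`. -/
theorem wsuux_high_prob_lower_bound_phase_one (T : ℕ) (η γ : ℝ)
    (hvalid : validParams 2 η γ) (δ : ℝ) (hδ0 : 0 < δ) (hδ1 : δ < 1)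
    (hε0 : 0 < eps1 T γ δ) (hε1 : eps1 T γ δ ≤ 1)
    (Ω : Type) [MeasurableSpace Ω] (P : Measure Ω) [IsProbabilityMeasure P]
    (run : WSUUX 2 T η γ (hardLoss T) Ω P) :
    ENNReal.ofReal (1 - δ) ≤
      P {ω | (2 : ℝ) ^ (-(Mexp T η γ δ)) ≤ run.pi (T / 100 + 1) ω 0} := by
  obtain ⟨hη, -, hγ, hγ', -⟩ := id hvalid
  set n : ℕ := T / 100 with hn
  set ε := eps1 T γ δ with hε
  have hsq : ε ^ 2 * (γ * n) / 3 = Real.log (1 / δ) := by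
    have harg := Real.sqrt_pos.1 hε0
    rw [← hn] at harg
    have hden : 2 * γ / 2 * (n : ℝ) ≠ 0 := fun h => by rw [h, div_zero] at harg; exact harg.false
    have hε2 : ε ^ 2 = 3 * Real.log (1 / δ) / (2 * γ / 2 * n) := by
      rw [hε, eps1, ← hn, Real.sq_sqrt harg.le]
    have hn0 : (n : ℝ) ≠ 0 := right_ne_zero_of_mul hden
    rw [hε2]
    field_simp
  have hbad := measureReal_lowWeightDraws_ge_le hvalid hε0.le hε1 run (n := n) hn.le
  rw [hsq, one_div, Real.log_inv, neg_neg, Real.exp_log hδ0] at hbad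
  have hmeas : MeasurableSet {ω | (1 + ε) * γ * n ≤ lowWeightDraws run n ω} :=
    measurableSet_le measurable_const
      (measurable_from_nat.comp ((measurable_lowWeightDraws run n).mono (run.F_le n) le_rfl))
  have hgood : 1 - δ ≤ P.real {ω | (1 + ε) * γ * n ≤ lowWeightDraws run n ω}ᶜ := by
    rw [probReal_compl_eq_one_sub hmeas]
    linarith
  refine (ENNReal.ofReal_le_ofReal hgood).trans ?_
  rw [ofReal_measureReal]
  refine measure_mono fun ω hω => ?_
  simp only [Set.mem_compl_iff, Set.mem_ofPred_eq, not_le] at hω ⊢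
  refine le_trans ?_ (exp_neg_lowWeightDraws_le_pi_zero hvalid run hn.le ω)
  have hexp : (2 : ℝ) ^ (-(Mexp T η γ δ)) =
      γ / 4 * Real.exp (-(η * 2 / γ * (1 + η * 2 / γ)) * ((1 + ε) * γ * n)) := by
    have hlog2 : Real.log 2 ≠ 0 := (Real.log_pos one_lt_two).ne'
    rw [Real.rpow_def_of_pos two_pos, Mexp, ← hn, ← hε, mul_neg, ← mul_assoc,
      mul_one_div_cancel hlog2, one_mul, neg_add, Real.exp_add, Real.exp_neg (Real.log _),
      Real.exp_log (by positivity), mul_comm]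
    congr 1
    · field_simp
      norm_num
    · congr 1
      field_simp
  rw [hexp]
  refine mul_le_mul_of_nonneg_left (Real.exp_le_exp.2 ?_) (by positivity)
  exact mul_le_mul_of_nonpos_left hω.le (neg_nonpos.2 (by positivity))
end

section
/- When WSU-UX with K = 2 arms and any valid hyperparameter setting (η, γ) is run on the hard loss sequence, the following holds for every realization of the algorithm's randomness: if t₀ > T₁ is a round with 0 < π_{t₀,1} ≤ 1/4, and arm 2 is pulled m times in rounds t₁ < t₂ < ... < t_m with t₀ ≤ t₁ and t_m ≤ T, where m ≥ (2/η)·1/(1 − 2π_{t₀,1}), then π_{t_m+1,1} ≥ 2·π_{t₀,1}. -/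
open MeasureTheory ProbabilityTheory Real Finset

namespace WSUUX

section Simplex

variable {K T : ℕ} {η γ : ℝ} {ℓ : ℕ → Fin K → ℝ} {Ω : Type} [MeasurableSpace Ω]
  {P : Measure Ω}

/-- The weights maintained by WSU-UX always sum to one. -/
theorem sum_pi_eq_one (run : WSUUX K T η γ ℓ Ω P) (hK : K ≠ 0) (ω : Ω) {t : ℕ} (ht : 1 ≤ t) :
    ∑ i, run.pi t ω i = 1 := by
  induction t, ht using Nat.le_induction with
  | base =>
    have : (K : ℝ) ≠ 0 := Nat.cast_ne_zero.mpr hK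
    simp [run.pi_init, this]
  | succ t ht ih =>
    simp only [run.update t ht ω]
    set L : Fin K → ℝ := fun i =>
      ℓ t i * (if run.I t ω = i then 1 else 0) / ((1 - γ) * run.pi t ω i + γ / K)
    set S := ∑ j, run.pi t ω j * L j with hS
    have hsplit : ∀ i, run.pi t ω i * (1 - η * (L i - S))
        = run.pi t ω i - η * (run.pi t ω i * L i) + η * S * run.pi t ω i := fun i => by ring
    calc ∑ i, run.pi t ω i * (1 - η * (L i - S))
        = ∑ i, run.pi t ω i - η * S + η * S * ∑ i, run.pi t ω i := by
          simp only [hsplit, sum_add_distrib, sum_sub_distrib, ← mul_sum]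
          rw [← hS]
      _ = 1 := by rw [ih]; ring

end Simplex

section HardLoss

variable {T : ℕ} {η γ : ℝ} {Ω : Type} [MeasurableSpace Ω] {P : Measure Ω}

theorem pi_one_eq (run : WSUUX 2 T η γ (hardLoss T) Ω P) (ω : Ω) {t : ℕ} (ht : 1 ≤ t) :
    run.pi t ω 1 = 1 - run.pi t ω 0 := by
  have h := run.sum_pi_eq_one two_ne_zero ω ht
  rw [Fin.sum_univ_two] at h
  linarith

/-- In Phase 2 the weights do not change when arm 1 is pulled. -/
theorem pi_succ_of_pull_zero (run : WSUUX 2 T η γ (hardLoss T) Ω P) {ω : Ω} {t : ℕ}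
    (ht : T / 100 < t) (hI : run.I t ω = 0) : run.pi (t + 1) ω 0 = run.pi t ω 0 := by
  rw [run.update t (by omega) ω 0]
  simp [hardLoss, ht.not_ge, hI]

/-- The Phase 2 update of the weight of arm 1 when arm 2 is pulled. -/
theorem pi_succ_of_pull_one (run : WSUUX 2 T η γ (hardLoss T) Ω P) {ω : Ω} {t : ℕ}
    (ht : T / 100 < t) (hI : run.I t ω = 1) :
    run.pi (t + 1) ω 0 = run.pi t ω 0 *
      (1 + η * ((1 - run.pi t ω 0) / ((1 - γ) * (1 - run.pi t ω 0) + γ / 2))) := by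
  rw [run.update t (by omega) ω 0]
  simp [hardLoss, ht.not_ge, hI, run.pi_one_eq ω (show 1 ≤ t by omega), div_eq_mul_inv]

/-- In Phase 2 the weight of arm 1 does not decrease and stays in `[0, 1]`. -/
theorem pi_zero_step (run : WSUUX 2 T η γ (hardLoss T) Ω P) (hvalid : validParams 2 η γ)
    {ω : Ω} {t : ℕ} (ht : T / 100 < t) (h0 : 0 ≤ run.pi t ω 0) (h1 : run.pi t ω 0 ≤ 1) :
    run.pi t ω 0 ≤ run.pi (t + 1) ω 0 ∧ run.pi (t + 1) ω 0 ≤ 1 := by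
  obtain ⟨hη, -, hγ, hγ', hηγ⟩ := hvalid
  obtain hI | hI : run.I t ω = 0 ∨ run.I t ω = 1 := by omega
  · rw [run.pi_succ_of_pull_zero ht hI]
    exact ⟨le_rfl, h1⟩
  · rw [run.pi_succ_of_pull_one ht hI]
    set p := run.pi t ω 0
    rw [div_le_iff₀ hγ] at hηγ
    push_cast at hηγ
    have hq : 0 ≤ 1 - p := by linarith
    have hmix : 0 ≤ (1 - γ) * (1 - p) := mul_nonneg (by linarith) hq
    have hd : 0 < (1 - γ) * (1 - p) + γ / 2 := by positivity
    constructor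
    · exact le_mul_of_one_le_right h0 (le_add_of_nonneg_right (by positivity))
    · have hinc : η * p / ((1 - γ) * (1 - p) + γ / 2) ≤ 1 := by
        rw [div_le_one hd]
        nlinarith
      calc p * (1 + η * ((1 - p) / ((1 - γ) * (1 - p) + γ / 2)))
          = p + (1 - p) * (η * p / ((1 - γ) * (1 - p) + γ / 2)) := by ring
        _ ≤ p + (1 - p) * 1 := by gcongr
        _ = 1 := by ring

/-- In Phase 2 the weight of arm 1 is monotone in time and stays at most one. -/
theorem pi_zero_mono (run : WSUUX 2 T η γ (hardLoss T) Ω P) (hvalid : validParams 2 η γ)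
    {ω : Ω} {t u : ℕ} (ht : T / 100 < t) (h0 : 0 ≤ run.pi t ω 0) (h1 : run.pi t ω 0 ≤ 1)
    (htu : t ≤ u) : run.pi t ω 0 ≤ run.pi u ω 0 ∧ run.pi u ω 0 ≤ 1 := by
  induction u, htu using Nat.le_induction with
  | base => exact ⟨le_rfl, h1⟩
  | succ u htu ih =>
    have h := run.pi_zero_step hvalid (ht.trans_le htu) (h0.trans ih.1) ih.2
    exact ⟨ih.1.trans h.1, h.2⟩

/-- In Phase 2, pulling arm 2 multiplies the weight of arm 1 by at least `1 + η`
as long as this weight is at most `1 / 2`. -/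
theorem pi_zero_mul_le_of_pull_one (run : WSUUX 2 T η γ (hardLoss T) Ω P)
    (hvalid : validParams 2 η γ) {ω : Ω} {t : ℕ} (ht : T / 100 < t) (hI : run.I t ω = 1)
    (h0 : 0 ≤ run.pi t ω 0) (hhalf : run.pi t ω 0 ≤ 1 / 2) :
    run.pi t ω 0 * (1 + η) ≤ run.pi (t + 1) ω 0 := by
  obtain ⟨hη, -, hγ, hγ', -⟩ := hvalid
  rw [run.pi_succ_of_pull_one ht hI]
  set p := run.pi t ω 0
  have hd : 0 < (1 - γ) * (1 - p) + γ / 2 := by nlinarith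
  have hratio : 1 ≤ (1 - p) / ((1 - γ) * (1 - p) + γ / 2) := by
    rw [one_le_div hd]
    nlinarith
  gcongr
  exact le_mul_of_one_le_right hη.le hratio

end HardLoss

end WSUUX

/-- When WSU-UX with `K = 2` arms and any valid `(η, γ)` is run on the
hard loss sequence, the following holds for every realization: if `t₀ > T₁` is a round
with `0 < π_{t₀,1} ≤ 1/4`, and arm 2 is pulled `m` times in rounds
`t₁ < t₂ < … < t_m` with `t₀ ≤ t₁` and `t_m ≤ T`, where
`m ≥ (2/η)·1/(1 − 2π_{t₀,1})`, then `π_{t_m+1,1} ≥ 2·π_{t₀,1}`. -/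
theorem wsuux_doubling_lemma (T : ℕ) (η γ : ℝ) (hvalid : validParams 2 η γ)
    (Ω : Type) [MeasurableSpace Ω] (P : Measure Ω) [IsProbabilityMeasure P]
    (run : WSUUX 2 T η γ (hardLoss T) Ω P) (ω : Ω)
    (t₀ : ℕ) (ht₀ : T / 100 < t₀)
    (hpos : 0 < run.pi t₀ ω 0) (hquarter : run.pi t₀ ω 0 ≤ 1 / 4)
    (m : ℕ) (hm : 0 < m)
    (hcount : (2 / η) * (1 / (1 - 2 * run.pi t₀ ω 0)) ≤ (m : ℝ))
    (s : Fin m → ℕ) (hmono : StrictMono s)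
    (hfirst : t₀ ≤ s ⟨0, hm⟩)
    (hlast : s ⟨m - 1, Nat.sub_lt hm Nat.one_pos⟩ ≤ T)
    (hpull : ∀ k, run.I (s k) ω = 1) :
    2 * run.pi t₀ ω 0 ≤ run.pi (s ⟨m - 1, Nat.sub_lt hm Nat.one_pos⟩ + 1) ω 0 := by
  have ⟨hη, _⟩ := hvalid
  set p₀ := run.pi t₀ ω 0
  have hmono' : ∀ {t u}, t₀ ≤ t → t ≤ u → run.pi t ω 0 ≤ run.pi u ω 0 := fun {t u} ht htu => by
    have h := run.pi_zero_mono hvalid ht₀ hpos.le (by linarith) ht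
    exact (run.pi_zero_mono hvalid (ht₀.trans_le ht) (hpos.le.trans h.1) h.2 htu).1
  have hstep : ∀ (k : Fin m) (c : ℝ), t₀ ≤ s k →
      2 * p₀ ≤ run.pi (s k) ω 0 ∨ c ≤ run.pi (s k) ω 0 →
      2 * p₀ ≤ run.pi (s k + 1) ω 0 ∨ c + η * p₀ ≤ run.pi (s k + 1) ω 0 := by
    intro k c hk h
    have hinc := hmono' hk (Nat.le_add_right (s k) 1)
    by_cases hbig : 2 * p₀ ≤ run.pi (s k) ω 0
    · exact Or.inl (hbig.trans hinc)
    · have hle : p₀ ≤ run.pi (s k) ω 0 := hmono' le_rfl hk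
      have hgain := run.pi_zero_mul_le_of_pull_one hvalid (ht₀.trans_le hk) (hpull k)
        (hpos.le.trans hle) (by linarith)
      have hc := h.resolve_left hbig
      right
      nlinarith
  have hs : ∀ k, t₀ ≤ s k := fun k =>
    hfirst.trans (hmono.monotone (Fin.mk_le_of_le_val (Nat.zero_le _)))
  have hgrowth : ∀ (k : ℕ) (hk : k < m), 2 * p₀ ≤ run.pi (s ⟨k, hk⟩ + 1) ω 0 ∨
      p₀ + (k + 1) * (η * p₀) ≤ run.pi (s ⟨k, hk⟩ + 1) ω 0 := by
    intro k
    induction k with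
    | zero =>
      intro hk
      simpa using hstep ⟨0, hk⟩ p₀ hfirst (Or.inr (hmono' le_rfl hfirst))
    | succ k ih =>
      intro hk
      have hlt : s ⟨k, by omega⟩ + 1 ≤ s ⟨k + 1, hk⟩ := hmono (Fin.mk_lt_mk.mpr k.lt_succ_self)
      have hle := hmono' (Nat.le_succ_of_le (hs _)) hlt
      have h := hstep ⟨k + 1, hk⟩ (p₀ + (k + 1) * (η * p₀)) (hs _)
        ((ih (by omega)).imp (fun h => h.trans hle) (fun h => h.trans hle))
      refine h.imp id fun h => le_trans (le_of_eq ?_) h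
      push_cast
      ring
  refine (hgrowth (m - 1) _).elim id fun h => le_trans ?_ h
  have hm' : ((m - 1 : ℕ) : ℝ) + 1 = m := by
    rw [Nat.cast_sub hm]
    simp
  have hmη : 1 ≤ m * η := by
    have hone : 1 ≤ 1 / (1 - 2 * p₀) := by
      rw [one_le_div (by linarith)]
      linarith
    have hlow : 2 / η ≤ m := (le_mul_of_one_le_right (by positivity) hone).trans hcount
    rw [div_le_iff₀ hη] at hlow
    linarith
  rw [hm']
  nlinarith
end

section
/- When WSU-UX with K = 2 arms and any valid hyperparameter setting (η, γ) is run on the hard loss sequence, the following holds for every realization of the algorithm's randomness: if t > T₁ is a round with 2^{−m} ≤ π_{t,1} ≤ 2^{−(m−1)} for a positive integer m, and arm 2 is pulled k = (2/η)·m times during rounds t, t+1, ..., T, then letting t′ denote the round just after the k-th such pull, π_{t′,1} ≥ 1/4. -/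
open MeasureTheory ProbabilityTheory Real Finset

/-- In the second phase the loss vector is `(0, 1)`. -/
theorem hardLoss_of_lt {T n : ℕ} (h : T / 100 < n) (i : Fin 2) :
    hardLoss T n i = if i = 0 then 0 else 1 := by
  simp [hardLoss, Nat.not_le.mpr h]

theorem hardLoss_mem (T n : ℕ) (i : Fin 2) :
    0 ≤ hardLoss T n i ∧ hardLoss T n i ≤ 1 := by
  unfold hardLoss
  split_ifs <;> norm_num

theorem validParams.loss_estimate_bounds {η γ p l : ℝ} (h : validParams 2 η γ) (hp : 0 ≤ p)
    (hl0 : 0 ≤ l) (hl1 : l ≤ 1) :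
    0 ≤ l / ((1 - γ) * p + γ / 2) ∧ η * (l / ((1 - γ) * p + γ / 2)) ≤ 1 := by
  obtain ⟨hη, -, hγ, hγ', hηγ⟩ := h
  have hq : γ / 2 ≤ (1 - γ) * p + γ / 2 := by nlinarith
  have hq0 : 0 < (1 - γ) * p + γ / 2 := by linarith
  refine ⟨by positivity, ?_⟩
  rw [div_le_iff₀ hγ] at hηγ
  push_cast at hηγ
  rw [mul_div_assoc', div_le_one hq0]
  nlinarith

namespace WSUUX

variable {T : ℕ} {η γ : ℝ} {Ω : Type} [MeasurableSpace Ω] {P : Measure Ω}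

/-- The iterates of the algorithm stay in the probability simplex. -/
theorem pi_mem_simplex (hvalid : validParams 2 η γ) (run : WSUUX 2 T η γ (hardLoss T) Ω P)
    (ω : Ω) {n : ℕ} (hn : 1 ≤ n) :
    0 ≤ run.pi n ω 0 ∧ 0 ≤ run.pi n ω 1 ∧ run.pi n ω 0 + run.pi n ω 1 = 1 := by
  induction n, hn using Nat.le_induction with
  | base => simp only [run.pi_init]; norm_num
  | succ n hn ih =>
    obtain ⟨h0, h1, hsum⟩ := ih
    have hest : ∀ i, 0 ≤ run.pi n ω i →
        0 ≤ hardLoss T n i * (if run.I n ω = i then 1 else 0)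
            / ((1 - γ) * run.pi n ω i + γ / 2) ∧
          η * (hardLoss T n i * (if run.I n ω = i then 1 else 0)
            / ((1 - γ) * run.pi n ω i + γ / 2)) ≤ 1 := by
      intro i hi
      obtain ⟨hl0, hl1⟩ := hardLoss_mem T n i
      apply hvalid.loss_estimate_bounds hi <;> split_ifs <;> simp [hl0, hl1]
    have e0 := hest 0 h0
    have e1 := hest 1 h1
    have hη := hvalid.1
    simp only [run.update n hn ω, Fin.sum_univ_two, Nat.cast_ofNat]
    generalize hardLoss T n 0 * _ / ((1 - γ) * run.pi n ω 0 + γ / 2) = a at *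
    generalize hardLoss T n 1 * _ / ((1 - γ) * run.pi n ω 1 + γ / 2) = b at *
    generalize run.pi n ω 0 = p at *
    generalize run.pi n ω 1 = q at *
    obtain rfl : q = 1 - p := by linarith
    have havg : 0 ≤ η * (p * a + (1 - p) * b) :=
      mul_nonneg hη.le (add_nonneg (mul_nonneg h0 e0.1) (mul_nonneg h1 e1.1))
    refine ⟨mul_nonneg h0 ?_, mul_nonneg h1 ?_, by ring⟩ <;> nlinarith [e0.2, e1.2]

/-- In the second phase, the update of the weight of arm 1 after a pull of arm 2. -/
theorem pi_succ_of_pull (run : WSUUX 2 T η γ (hardLoss T) Ω P)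
    (ω : Ω) {n : ℕ} (hn : T / 100 < n) (hI : run.I n ω = 1) :
    run.pi (n + 1) ω 0 = run.pi n ω 0 *
      (1 + η * (run.pi n ω 1 / ((1 - γ) * run.pi n ω 1 + γ / 2))) := by
  simp only [run.update n (by omega) ω, Fin.sum_univ_two, hardLoss_of_lt hn, hI]
  simp [div_eq_mul_inv]

theorem pi_le_pi_succ (hvalid : validParams 2 η γ) (run : WSUUX 2 T η γ (hardLoss T) Ω P)
    (ω : Ω) {n : ℕ} (hn : T / 100 < n) : run.pi n ω 0 ≤ run.pi (n + 1) ω 0 := by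
  by_cases hI : run.I n ω = 1
  · obtain ⟨h0, h1, -⟩ := run.pi_mem_simplex hvalid ω (n := n) (by omega)
    rw [run.pi_succ_of_pull ω hn hI]
    obtain ⟨hη, -, hγ, hγ', -⟩ := hvalid
    have : 0 ≤ 1 - γ := by linarith
    exact le_mul_of_one_le_right h0 (le_add_of_nonneg_right (by positivity))
  · have hI0 : run.I n ω = 0 := by omega
    simp [run.update n (by omega) ω, Fin.sum_univ_two, hardLoss_of_lt hn, hI0]

theorem pi_mono (hvalid : validParams 2 η γ) (run : WSUUX 2 T η γ (hardLoss T) Ω P)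
    (ω : Ω) {a b : ℕ} (ha : T / 100 < a) (hab : a ≤ b) : run.pi a ω 0 ≤ run.pi b ω 0 := by
  induction b, hab using Nat.le_induction with
  | base => exact le_rfl
  | succ n hn ih => exact ih.trans (run.pi_le_pi_succ hvalid ω (by omega))

/-- In the second phase, a pull of arm 2 multiplies the weight of arm 1 by at least `1 + η`
while that weight is at most `1/2`. -/
theorem mul_pi_le_pi_succ (hvalid : validParams 2 η γ)
    (run : WSUUX 2 T η γ (hardLoss T) Ω P) (ω : Ω) {n : ℕ} (hn : T / 100 < n)
    (hI : run.I n ω = 1) (hp : run.pi n ω 0 ≤ 1 / 2) :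
    run.pi n ω 0 * (1 + η) ≤ run.pi (n + 1) ω 0 := by
  obtain ⟨h0, h1, hsum⟩ := run.pi_mem_simplex hvalid ω (n := n) (by omega)
  rw [run.pi_succ_of_pull ω hn hI]
  obtain ⟨hη, -, hγ, hγ', -⟩ := hvalid
  have hq : 0 < (1 - γ) * run.pi n ω 1 + γ / 2 := by nlinarith
  have hratio : 1 ≤ run.pi n ω 1 / ((1 - γ) * run.pi n ω 1 + γ / 2) := by
    rw [one_le_div hq]
    nlinarith
  gcongr
  exact le_mul_of_one_le_right hη.le hratio

/-- After `j + 1` pulls of arm 2 in the second phase, the weight of arm 1 has either reached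
`1/2` or grown by a factor of at least `(1 + η) ^ (j + 1)`. -/
theorem half_le_or_mul_pow_le_pi (hvalid : validParams 2 η γ)
    (run : WSUUX 2 T η γ (hardLoss T) Ω P) (ω : Ω) {t k : ℕ} (ht : T / 100 < t)
    {s : Fin k → ℕ} (hmono : StrictMono s) (hts : ∀ j, t ≤ s j)
    (hpull : ∀ j, run.I (s j) ω = 1) (j : ℕ) (hj : j < k) :
    1 / 2 ≤ run.pi (s ⟨j, hj⟩ + 1) ω 0 ∨
      run.pi t ω 0 * (1 + η) ^ (j + 1) ≤ run.pi (s ⟨j, hj⟩ + 1) ω 0 := by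
  have hη := hvalid.1
  have hpos : T / 100 < s ⟨j, hj⟩ := ht.trans_le (hts _)
  have hbefore : 1 / 2 ≤ run.pi (s ⟨j, hj⟩) ω 0 ∨
      run.pi t ω 0 * (1 + η) ^ j ≤ run.pi (s ⟨j, hj⟩) ω 0 := by
    cases j with
    | zero => exact Or.inr (by simpa using run.pi_mono hvalid ω ht (hts _))
    | succ i =>
      have hi : i < k := by omega
      have hlt : s ⟨i, hi⟩ < s ⟨i + 1, hj⟩ := hmono (by simp)
      have hle : run.pi (s ⟨i, hi⟩ + 1) ω 0 ≤ run.pi (s ⟨i + 1, hj⟩) ω 0 :=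
        run.pi_mono hvalid ω ((ht.trans_le (hts _)).trans (Nat.lt_succ_self _)) hlt
      exact (run.half_le_or_mul_pow_le_pi hvalid ω ht hmono hts hpull i hi).imp
        (fun h => h.trans hle) (fun h => h.trans hle)
  rcases le_total (run.pi (s ⟨j, hj⟩) ω 0) (1 / 2) with hp | hp
  · have hstep := run.mul_pi_le_pi_succ hvalid ω hpos (hpull _) hp
    rcases hbefore with h | h
    · exact Or.inl (h.trans (run.pi_le_pi_succ hvalid ω hpos))
    · refine Or.inr (le_trans ?_ hstep)
      rw [pow_succ, ← mul_assoc]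
      gcongr
  · exact Or.inl (hp.trans (run.pi_le_pi_succ hvalid ω hpos))

end WSUUX

theorem two_pow_le_one_add_pow {η : ℝ} (hη : 0 < η) (hη1 : η ≤ 1) {m k : ℕ}
    (hk : (2 / η) * (m : ℝ) ≤ (k : ℝ)) : (2 : ℝ) ^ m ≤ (1 + η) ^ k := by
  have hceil : (⌈1 / η⌉₊ : ℝ) ≤ 2 / η := by
    have h1 : 1 ≤ 1 / η := (one_le_div hη).2 hη1
    have h2 := (Nat.ceil_lt_add_one (zero_le_one.trans h1)).le
    have h3 : 2 / η = 1 / η + 1 / η := by ring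
    linarith
  have hmk : ⌈1 / η⌉₊ * m ≤ k := by
    have : (⌈1 / η⌉₊ : ℝ) * m ≤ k := (by gcongr : _ ≤ 2 / η * (m : ℝ)).trans hk
    exact_mod_cast this
  have htwo : 2 ≤ (1 + η) ^ ⌈1 / η⌉₊ := by
    have h1 : 1 ≤ ⌈1 / η⌉₊ * η := (div_le_iff₀ hη).1 (Nat.le_ceil _)
    have h2 := one_add_mul_le_pow (by linarith : (-2 : ℝ) ≤ η) ⌈1 / η⌉₊
    linarith
  calc (2 : ℝ) ^ m ≤ ((1 + η) ^ ⌈1 / η⌉₊) ^ m := by gcongr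
    _ = (1 + η) ^ (⌈1 / η⌉₊ * m) := (pow_mul _ _ _).symm
    _ ≤ (1 + η) ^ k := pow_le_pow_right₀ (by linarith) hmk

/-- When WSU-UX with `K = 2` arms and any valid `(η, γ)` is run on the
hard loss sequence, the following holds for every realization: if `t > T₁` is a round
with `2^{−m} ≤ π_{t,1} ≤ 2^{−(m−1)}` for a positive integer `m`, and arm 2 is pulled
`k = (2/η)·m` times during rounds `t, t+1, …, T`, then letting `t′` denote the round
just after the `k`-th such pull, `π_{t′,1} ≥ 1/4`. -/
theorem wsuux_recovery_lemma (T : ℕ) (η γ : ℝ) (hvalid : validParams 2 η γ)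
    (Ω : Type) [MeasurableSpace Ω] (P : Measure Ω) [IsProbabilityMeasure P]
    (run : WSUUX 2 T η γ (hardLoss T) Ω P) (ω : Ω)
    (t : ℕ) (ht : T / 100 < t) (m : ℕ) (hm : 0 < m)
    (hlo : (2 : ℝ) ^ (-(m : ℤ)) ≤ run.pi t ω 0)
    (hhi : run.pi t ω 0 ≤ (2 : ℝ) ^ (-((m : ℤ) - 1)))
    (k : ℕ) (hk0 : 0 < k) (hk : (2 / η) * (m : ℝ) ≤ (k : ℝ))
    (s : Fin k → ℕ) (hmono : StrictMono s)
    (hfirst : t ≤ s ⟨0, hk0⟩)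
    (hlast : s ⟨k - 1, Nat.sub_lt hk0 Nat.one_pos⟩ ≤ T)
    (hpull : ∀ j, run.I (s j) ω = 1) :
    (1 / 4 : ℝ) ≤ run.pi (s ⟨k - 1, Nat.sub_lt hk0 Nat.one_pos⟩ + 1) ω 0 := by
  have hts : ∀ j, t ≤ s j := fun j =>
    hfirst.trans (hmono.monotone (Fin.mk_le_of_le_val (Nat.zero_le _)))
  rcases run.half_le_or_mul_pow_le_pi hvalid ω ht hmono hts hpull (k - 1)
    (Nat.sub_lt hk0 Nat.one_pos) with h | h
  · linarith
  · rw [Nat.sub_add_cancel hk0] at h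
    have hpow := two_pow_le_one_add_pow hvalid.1 (by linarith [hvalid.2.1]) hk
    have hone : 1 ≤ run.pi t ω 0 * (1 + η) ^ k := by
      calc (1 : ℝ) = (2 : ℝ) ^ (-(m : ℤ)) * 2 ^ m := by simp
        _ ≤ run.pi t ω 0 * (1 + η) ^ k := by
          gcongr
          exact le_trans (by positivity) hlo
    linarith
end
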